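/- Let ψ, F : ℝ → ℝ be continuous, let a' < b' and let f : [a',b'] → ℝ be continuous, let a < b be real numbers, and let φ₂, φ₃ : ℝ → ℝ be mollifiers (nonnegative, supported in (−1,1), of integral 1), with φ_j^ε(s) := ε^{−1} φ_j(s/ε). Then the integral J^ε := ∫_{a'}^{b'} ψ(s₁) f(s₁) φ₂^ε(s₁ − b) ( ∫_a^b F(s₃) φ₃^ε(s₁ − s₃) ds₃ ) ds₁ converges, as ε → 0, to ψ(b) F(b) ( A⁺_{2,3} f(b) 1_{a' < b < b'} + B⁺_{2,3} f(a') 1_{b = a'} + C⁺_{2,3} f(b') 1_{b = b'} ), where B⁺_{2,3} := ∫_0^∞ ∫_{y₁}^∞ φ₂(y₁) φ₃(y₃) dy₃ dy₁, C⁺_{2,3} := ∫_{−∞}^0 ∫_{y₁}^∞ φ₂(y₁) φ₃(y₃) dy₃ dy₁, and A⁺_{2,3} := B⁺_{2,3} + C⁺_{2,3}. -/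

import Mathlib

open MeasureTheory Real Set Filter Topology

noncomputable section

/-- A mollifier: nonnegative, supported in `(−1,1)`, of integral `1`. -/
def IsMollifier (φ : ℝ → ℝ) : Prop :=
  Continuous φ ∧ (∀ y, 0 ≤ φ y) ∧
  (∀ y : ℝ, y ∉ Set.Ioo (-1 : ℝ) 1 → φ y = 0) ∧ (∫ y : ℝ, φ y) = 1

/-- `B⁻_{2,3} = ∫_0^∞ ∫_{−∞}^{y₁} φ₂(y₁) φ₃(y₃) dy₃ dy₁`. -/
def Bminus (φ₂ φ₃ : ℝ → ℝ) : ℝ :=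
  ∫ y₁ in Set.Ioi (0 : ℝ), ∫ y₃ in Set.Iic y₁, φ₂ y₁ * φ₃ y₃

/-- `C⁻_{2,3} = ∫_{−∞}^0 ∫_{−∞}^{y₁} φ₂(y₁) φ₃(y₃) dy₃ dy₁`. -/
def Cminus (φ₂ φ₃ : ℝ → ℝ) : ℝ :=
  ∫ y₁ in Set.Iio (0 : ℝ), ∫ y₃ in Set.Iic y₁, φ₂ y₁ * φ₃ y₃

/-- `B⁺_{2,3} = ∫_0^∞ ∫_{y₁}^∞ φ₂(y₁) φ₃(y₃) dy₃ dy₁`. -/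
def Bplus (φ₂ φ₃ : ℝ → ℝ) : ℝ :=
  ∫ y₁ in Set.Ioi (0 : ℝ), ∫ y₃ in Set.Ioi y₁, φ₂ y₁ * φ₃ y₃

/-- `C⁺_{2,3} = ∫_{−∞}^0 ∫_{y₁}^∞ φ₂(y₁) φ₃(y₃) dy₃ dy₁`. -/
def Cplus (φ₂ φ₃ : ℝ → ℝ) : ℝ :=
  ∫ y₁ in Set.Iio (0 : ℝ), ∫ y₃ in Set.Ioi y₁, φ₂ y₁ * φ₃ y₃

/-- Rescaling around `b`: the substitution `s = b + ε y` on the real line. -/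
lemma integral_rescale (h : ℝ → ℝ) (b : ℝ) {ε : ℝ} (hε : 0 < ε) :
    ∫ s, ε⁻¹ * h s = ∫ y, h (b + ε * y) := by
  rw [Measure.integral_comp_mul_left (fun x => h (b + x)) ε,
    integral_add_left_eq_self h b, integral_const_mul, abs_of_pos (inv_pos.2 hε), smul_eq_mul]

lemma tendsto_add_mul_nhds_zero (b y : ℝ) :
    Tendsto (fun ε : ℝ => b + ε * y) (𝓝[>] 0) (𝓝 b) := by
  have : Continuous fun ε : ℝ => b + ε * y := by fun_prop
  simpa using (this.tendsto 0).mono_left nhdsWithin_le_nhds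

/-- Concentration of a rescaled kernel `k` on an interval `(c, d]` around the point `b`;
`S` is the limit of the rescaled intervals. -/
lemma tendsto_integral_rescaled_kernel {c d b M : ℝ} (hcd : c ≤ d) {g k L : ℝ → ℝ}
    {H : ℝ → ℝ → ℝ} {S : Set ℝ} (hg : Continuous g) (hkc : Continuous k) (hk : Integrable k)
    (hS : MeasurableSet S)
    (hmem : ∀ᵐ y : ℝ, ∀ᶠ ε in 𝓝[>] (0 : ℝ), b + ε * y ∈ Ioc c d ↔ y ∈ S)
    (hHm : ∀ᶠ ε in 𝓝[>] (0 : ℝ), Measurable (H ε))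
    (hHb : ∀ᶠ ε in 𝓝[>] (0 : ℝ), ∀ y, |H ε y| ≤ M)
    (hHL : ∀ y, Tendsto (fun ε => H ε y) (𝓝[>] 0) (𝓝 (L y))) :
    Tendsto (fun ε => ∫ s in c..d, g s * (ε⁻¹ * k ((s - b) / ε)) * H ε ((s - b) / ε))
      (𝓝[>] 0) (𝓝 (∫ y in S, g b * k y * L y)) := by
  obtain ⟨K, hK⟩ := isCompact_Icc.exists_bound_of_continuousOn (s := Icc c d) hg.continuousOn
  have hK0 : 0 ≤ K := (norm_nonneg _).trans (hK c ⟨le_rfl, hcd⟩)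
  have hpos : ∀ᶠ ε in 𝓝[>] (0 : ℝ), 0 < ε := self_mem_nhdsWithin
  have hsubst : ∀ᶠ ε in 𝓝[>] (0 : ℝ),
      ∫ y, (Ioc c d).indicator g (b + ε * y) * k y * H ε y =
      ∫ s in c..d, g s * (ε⁻¹ * k ((s - b) / ε)) * H ε ((s - b) / ε) := by
    filter_upwards [hpos] with ε hε
    rw [intervalIntegral.integral_of_le hcd, ← integral_indicator measurableSet_Ioc]
    have := integral_rescale
      (fun s => (Ioc c d).indicator g s * k ((s - b) / ε) * H ε ((s - b) / ε)) b hε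
    simp only [add_sub_cancel_left, mul_div_cancel_left₀ _ hε.ne'] at this
    rw [← this]
    congr 1
    ext s
    by_cases hs : s ∈ Ioc c d
    · simp only [indicator_of_mem hs]; ring
    · simp only [indicator_of_notMem hs]; ring
  refine Tendsto.congr' hsubst ?_
  rw [← integral_indicator hS]
  refine tendsto_integral_filter_of_dominated_convergence (fun y => K * |k y| * M) ?_ ?_ ?_ ?_
  · filter_upwards [hHm] with ε hm
    have h1 : Measurable fun y => (Ioc c d).indicator g (b + ε * y) :=
      (hg.measurable.indicator measurableSet_Ioc).comp (by fun_prop)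
    exact ((h1.mul hkc.measurable).mul hm).aestronglyMeasurable
  · filter_upwards [hHb] with ε hb
    refine ae_of_all _ fun y => ?_
    rw [norm_mul, norm_mul]
    have h1 : ‖(Ioc c d).indicator g (b + ε * y)‖ ≤ K := by
      by_cases hs : b + ε * y ∈ Ioc c d
      · rw [indicator_of_mem hs]; exact hK _ (Ioc_subset_Icc_self hs)
      · rw [indicator_of_notMem hs]; simpa using hK0
    have h2 := hb y
    simp only [Real.norm_eq_abs] at h1 ⊢
    gcongr
  · exact (hk.abs.const_mul K).mul_const M
  · filter_upwards [hmem] with y hy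
    by_cases hyS : y ∈ S
    · rw [indicator_of_mem hyS]
      refine ((((hg.tendsto b).comp (tendsto_add_mul_nhds_zero b y)).mul_const (k y)).mul (hHL y)).congr' ?_
      filter_upwards [hy] with ε h
      rw [indicator_of_mem (h.2 hyS), Function.comp_apply]
    · rw [indicator_of_notMem hyS]
      refine tendsto_const_nhds.congr' ?_
      filter_upwards [hy] with ε h
      rw [indicator_of_notMem (fun hh => hyS (h.1 hh)), zero_mul, zero_mul]

/-- The rescaled intervals at an interior point exhaust the line. -/
lemma eventually_mem_Ioc_of_mem_Ioo {c d b : ℝ} (hb : b ∈ Ioo c d) (y : ℝ) :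
    ∀ᶠ ε in 𝓝[>] (0 : ℝ), b + ε * y ∈ Ioc c d ↔ y ∈ univ := by
  filter_upwards [(tendsto_add_mul_nhds_zero b y).eventually (Ioo_mem_nhds hb.1 hb.2)] with ε h
  simpa using Ioo_subset_Ioc_self h

/-- The rescaled intervals at an exterior point escape to infinity. -/
lemma eventually_mem_Ioc_of_notMem_Icc {c d b : ℝ} (hb : b ∉ Icc c d) (y : ℝ) :
    ∀ᶠ ε in 𝓝[>] (0 : ℝ), b + ε * y ∈ Ioc c d ↔ y ∈ (∅ : Set ℝ) := by
  filter_upwards [(tendsto_add_mul_nhds_zero b y).eventually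
    (isClosed_Icc.isOpen_compl.mem_nhds hb)] with ε h
  simpa using fun hh : b + ε * y ∈ Ioc c d => h (Ioc_subset_Icc_self hh)

/-- The rescaled intervals at the left endpoint tend to the positive half-line. -/
lemma eventually_mem_Ioc_left {c d : ℝ} (hcd : c < d) (y : ℝ) :
    ∀ᶠ ε in 𝓝[>] (0 : ℝ), c + ε * y ∈ Ioc c d ↔ y ∈ Ioi (0 : ℝ) := by
  filter_upwards [(tendsto_add_mul_nhds_zero c y).eventually (Iio_mem_nhds hcd),
    self_mem_nhdsWithin] with ε h (hε : 0 < ε)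
  simp only [mem_Ioc, mem_Ioi, lt_add_iff_pos_right, mul_pos_iff_of_pos_left hε]
  exact and_iff_left (mem_Iio.1 h).le

/-- The rescaled intervals at the right endpoint tend to the negative half-line. -/
lemma eventually_mem_Ioc_right {c d : ℝ} (hcd : c < d) :
    ∀ᵐ y : ℝ, ∀ᶠ ε in 𝓝[>] (0 : ℝ), d + ε * y ∈ Ioc c d ↔ y ∈ Iio (0 : ℝ) := by
  filter_upwards [Measure.ae_ne volume (0 : ℝ)] with y hy
  filter_upwards [(tendsto_add_mul_nhds_zero d y).eventually (Ioi_mem_nhds hcd),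
    self_mem_nhdsWithin] with ε h (hε : 0 < ε)
  simp only [mem_Ioc, mem_Iio]
  refine ⟨fun hh => lt_of_le_of_ne ?_ hy, fun hh => ⟨h, ?_⟩⟩
  · by_contra! h0
    linarith [mul_pos hε h0, hh.2]
  · linarith [mul_neg_of_pos_of_neg hε hh]

lemma IsMollifier.integrable {φ : ℝ → ℝ} (h : IsMollifier φ) : Integrable φ :=
  Integrable.of_integral_ne_zero (by rw [h.2.2.2]; exact one_ne_zero)

lemma setIntegral_Iio_comp_sub_left (φ : ℝ → ℝ) (y : ℝ) :
    ∫ w in Iio (0 : ℝ), φ (y - w) = ∫ z in Ioi y, φ z := by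
  rw [← integral_indicator measurableSet_Iio, ← integral_indicator measurableSet_Ioi,
    ← integral_sub_left_eq_self ((Ioi y).indicator φ) volume y]
  congr 1
  ext w
  simp only [indicator, mem_Iio, mem_Ioi, lt_sub_comm (a := y), sub_self]

/-- A mollified continuous function on `[a, b]` is bounded by a bound of the function. -/
lemma IsMollifier.abs_integral_le {φ F : ℝ → ℝ} (hφ : IsMollifier φ) {a b M : ℝ}
    (hab : a ≤ b) (hM : ∀ s ∈ Icc a b, ‖F s‖ ≤ M) {ε : ℝ} (hε : 0 < ε) (y : ℝ) :
    |∫ s in a..b, F s * (ε⁻¹ * φ (y - (s - b) / ε))| ≤ M := by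
  have hM0 : 0 ≤ M := (norm_nonneg _).trans (hM a ⟨le_rfl, hab⟩)
  have hcont := hφ.1
  have hint : Integrable fun s => ε⁻¹ * φ (y - (s - b) / ε) :=
    (((hφ.integrable.comp_sub_left y).comp_div hε.ne').comp_sub_right b).const_mul _
  have htotal : ∫ s, ε⁻¹ * φ (y - (s - b) / ε) = 1 := by
    rw [integral_rescale (fun s => φ (y - (s - b) / ε)) b hε]
    simp only [add_sub_cancel_left, mul_div_cancel_left₀ _ hε.ne']
    rw [integral_sub_left_eq_self φ volume y, hφ.2.2.2]
  have hnn : ∀ s, 0 ≤ ε⁻¹ * φ (y - (s - b) / ε) := fun s =>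
    mul_nonneg (inv_nonneg.2 hε.le) (hφ.2.1 _)
  rw [intervalIntegral.integral_of_le hab, ← Real.norm_eq_abs]
  calc _ ≤ ∫ s in Ioc a b, M * (ε⁻¹ * φ (y - (s - b) / ε)) := by
        refine norm_integral_le_of_norm_le (hint.const_mul M).integrableOn ?_
        refine (ae_restrict_mem measurableSet_Ioc).mono fun s hs => ?_
        rw [norm_mul, Real.norm_of_nonneg (hnn s)]
        exact mul_le_mul_of_nonneg_right (hM s (Ioc_subset_Icc_self hs)) (hnn s)
    _ ≤ ∫ s, M * (ε⁻¹ * φ (y - (s - b) / ε)) :=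
        setIntegral_le_integral (hint.const_mul M)
          (ae_of_all _ fun s => mul_nonneg hM0 (hnn s))
    _ = M := by rw [integral_const_mul, htotal, mul_one]

/-- The one-sided limit of a mollification seen from the scale of the endpoint `b`. -/
lemma IsMollifier.tendsto_integral {φ F : ℝ → ℝ} (hφ : IsMollifier φ) (hF : Continuous F)
    {a b : ℝ} (hab : a < b) (y : ℝ) :
    Tendsto (fun ε => ∫ s in a..b, F s * (ε⁻¹ * φ (y - (s - b) / ε))) (𝓝[>] 0)
      (𝓝 (F b * ∫ z in Ioi y, φ z)) := by
  have hcont := hφ.1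
  have h := tendsto_integral_rescaled_kernel (H := fun _ _ => 1) (L := fun _ => 1) (M := 1)
    hab.le hF (k := fun w => φ (y - w)) (by fun_prop) (hφ.integrable.comp_sub_left y)
    measurableSet_Iio (eventually_mem_Ioc_right hab) (by simp) (by simp)
    (fun _ => tendsto_const_nhds)
  simpa only [mul_one, integral_const_mul, setIntegral_Iio_comp_sub_left] using h

lemma Bplus_add_Cplus {φ₂ φ₃ : ℝ → ℝ} (h₂ : IsMollifier φ₂) (h₃ : IsMollifier φ₃) :
    Bplus φ₂ φ₃ + Cplus φ₂ φ₃ = ∫ y, φ₂ y * ∫ z in Ioi y, φ₃ z := by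
  have hanti : Antitone fun y => ∫ z in Ioi y, φ₃ z := fun x y hxy =>
    setIntegral_mono_set h₃.integrable.integrableOn (ae_of_all _ h₃.2.1)
      (Ioi_subset_Ioi hxy).eventuallyLE
  have hint : Integrable fun y => φ₂ y * ∫ z in Ioi y, φ₃ z := by
    refine h₂.integrable.mul_bdd (c := 1) hanti.measurable.aestronglyMeasurable
      (ae_of_all _ fun y => ?_)
    rw [Real.norm_of_nonneg (integral_nonneg h₃.2.1), ← h₃.2.2.2]
    exact setIntegral_le_integral h₃.integrable (ae_of_all _ h₃.2.1)
  simp only [Bplus, Cplus, integral_const_mul]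
  rw [← integral_Iic_eq_integral_Iio, add_comm, ← compl_Iic]
  exact integral_add_compl measurableSet_Iic hint

/-- Lemma 5.3: a regularized nonconservative product.
As `ε → 0+`,
`J^ε = ∫_{a'}^{b'} ψ(s₁) f(s₁) φ₂^ε(s₁−b) (∫_a^b F(s₃) φ₃^ε(s₁−s₃) ds₃) ds₁`
converges to `ψ(b) F(b) (A⁺ f(b) 1_{a'<b<b'} + B⁺ f(a') 1_{b=a'} + C⁺ f(b') 1_{b=b'})`
with `A⁺ = B⁺ + C⁺` depending only on the mollifiers. -/
theorem nonconservative_product_limit_plus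
    (ψ F : ℝ → ℝ) (hψ : Continuous ψ) (hF : Continuous F)
    (a' b' : ℝ) (ha'b' : a' < b')
    (f : ℝ → ℝ) (hf : ContinuousOn f (Set.Icc a' b'))
    (a b : ℝ) (hab : a < b)
    (φ₂ φ₃ : ℝ → ℝ) (h₂ : IsMollifier φ₂) (h₃ : IsMollifier φ₃) :
    Tendsto (fun ε : ℝ =>
        ∫ s₁ in a'..b', ψ s₁ * f s₁ * (ε⁻¹ * φ₂ ((s₁ - b) / ε)) *
          ∫ s₃ in a..b, F s₃ * (ε⁻¹ * φ₃ ((s₁ - s₃) / ε)))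
      (𝓝[>] 0)
      (𝓝 (ψ b * F b *
        ((Bplus φ₂ φ₃ + Cplus φ₂ φ₃) * f b * (if a' < b ∧ b < b' then 1 else 0)
          + Bplus φ₂ φ₃ * f a' * (if b = a' then 1 else 0)
          + Cplus φ₂ φ₃ * f b' * (if b = b' then 1 else 0)))) := by
  set ft : ℝ → ℝ := IccExtend ha'b'.le ((Icc a' b').domRestrict f) with hft
  have hftc : Continuous ft := hf.domRestrict.Icc_extend'
  have hfeq : ∀ s ∈ Icc a' b', ft s = f s := fun s hs => by
    rw [hft, IccExtend_of_mem _ _ hs, domRestrict_apply]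
  obtain ⟨M, hM⟩ := isCompact_Icc.exists_bound_of_continuousOn (s := Icc a b) hF.continuousOn
  have hpos : ∀ᶠ ε in 𝓝[>] (0 : ℝ), 0 < ε := self_mem_nhdsWithin
  have hφ₃ := h₃.1
  have key : ∀ S : Set ℝ, MeasurableSet S →
      (∀ᵐ y : ℝ, ∀ᶠ ε in 𝓝[>] (0 : ℝ), b + ε * y ∈ Ioc a' b' ↔ y ∈ S) →
      Tendsto (fun ε : ℝ =>
        ∫ s₁ in a'..b', ψ s₁ * f s₁ * (ε⁻¹ * φ₂ ((s₁ - b) / ε)) *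
          ∫ s₃ in a..b, F s₃ * (ε⁻¹ * φ₃ ((s₁ - s₃) / ε)))
      (𝓝[>] 0) (𝓝 (ψ b * F b * (ft b * ∫ y in S, φ₂ y * ∫ z in Ioi y, φ₃ z))) := by
    intro S hS hmem
    have h := tendsto_integral_rescaled_kernel (M := M) ha'b'.le (hψ.mul hftc) h₂.1
      h₂.integrable hS hmem
      (H := fun ε y => ∫ s in a..b, F s * (ε⁻¹ * φ₃ (y - (s - b) / ε)))
      (Eventually.of_forall fun ε => Continuous.measurable <|
        intervalIntegral.continuous_parametric_intervalIntegral_of_continuous'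
          (by fun_prop) a b)
      (by filter_upwards [hpos] with ε hε y using h₃.abs_integral_le hab.le hM hε y)
      (h₃.tendsto_integral hF hab)
    convert h.congr' ?_ using 2
    · rw [← integral_const_mul, ← integral_const_mul]
      congr 1
      ext y
      simp only [Pi.mul_apply]
      ring
    · filter_upwards with ε
      refine intervalIntegral.integral_congr fun s hs => ?_
      rw [uIcc_of_le ha'b'.le] at hs
      simp only [Pi.mul_apply, hfeq s hs, ← sub_div, sub_sub_sub_cancel_right]
  have hB : Bplus φ₂ φ₃ = ∫ y in Ioi (0 : ℝ), φ₂ y * ∫ z in Ioi y, φ₃ z := by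
    simp only [Bplus, integral_const_mul]
  have hC : Cplus φ₂ φ₃ = ∫ y in Iio (0 : ℝ), φ₂ y * ∫ z in Ioi y, φ₃ z := by
    simp only [Cplus, integral_const_mul]
  by_cases hb : b ∈ Icc a' b'
  · rw [hfeq b hb] at key
    rcases hb.1.eq_or_lt with rfl | hlt
    · convert key _ measurableSet_Ioi (ae_of_all _ (eventually_mem_Ioc_left ha'b')) using 2
      simp [← hB, ha'b'.ne, mul_comm]
    rcases hb.2.eq_or_lt with rfl | hlt'
    · convert key _ measurableSet_Iio (eventually_mem_Ioc_right ha'b') using 2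
      simp [← hC, ha'b'.ne', mul_comm]
    · convert key _ MeasurableSet.univ
        (ae_of_all _ (eventually_mem_Ioc_of_mem_Ioo ⟨hlt, hlt'⟩)) using 2
      simp [hlt, hlt', hlt.ne', hlt'.ne, Bplus_add_Cplus h₂ h₃, mul_comm]
  · convert key _ MeasurableSet.empty
      (ae_of_all _ (eventually_mem_Ioc_of_notMem_Icc hb)) using 2
    have h1 : ¬(a' < b ∧ b < b') := fun h => hb ⟨h.1.le, h.2.le⟩
    have h2 : b ≠ a' := fun h => hb ⟨h.ge, h ▸ ha'b'.le⟩
    have h3 : b ≠ b' := fun h => hb ⟨h ▸ ha'b'.le, h.le⟩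
    simp [h1, h2, h3]
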